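/- ◊* implies both: (1) there exists a partial order which is Knaster but not stationarily Knaster, and (2) there exists a partial order which is stationarily Knaster but does not have stationary precaliber ω₁. -/

import Mathlib

noncomputable section

open Set

/-- The first uncountable ordinal. -/
def omega1 : Ordinal.{0} := (Cardinal.aleph 1).ord

/-- `C` is a closed unbounded subset of `ω₁`. -/
def IsClubOmega1 (C : Set Ordinal) : Prop :=
  C ⊆ Set.Iio omega1 ∧
  (∀ α < omega1, ∃ β ∈ C, α < β) ∧
  (∀ α < omega1, α ≠ 0 → (∀ β < α, ∃ γ ∈ C, β < γ ∧ γ < α) → α ∈ C)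

/-- `S` is a stationary subset of `ω₁`. -/
def IsStationaryOmega1 (S : Set Ordinal) : Prop :=
  S ⊆ Set.Iio omega1 ∧ ∀ C, IsClubOmega1 C → (S ∩ C).Nonempty

/-- Two conditions are compatible if they have a common lower bound. -/
def Compat {P : Type*} [PartialOrder P] (p q : P) : Prop := ∃ r, r ≤ p ∧ r ≤ q

/-- A set of conditions is linked if its elements are pairwise compatible. -/
def Linked {P : Type*} [PartialOrder P] (B : Set P) : Prop :=
  ∀ p ∈ B, ∀ q ∈ B, Compat p q

/-- A set of conditions is centered if each of its finite subsets has a lower bound. -/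
def Centered {P : Type*} [PartialOrder P] (B : Set P) : Prop :=
  ∀ F : Finset P, ↑F ⊆ B → ∃ r : P, ∀ p ∈ F, r ≤ p

/-- `P` is stationarily Knaster. -/
def StationarilyKnaster (P : Type*) [PartialOrder P] : Prop :=
  ∀ S : Set Ordinal, IsStationaryOmega1 S → ∀ p : Ordinal → P,
    ∃ T ⊆ S, IsStationaryOmega1 T ∧ ∀ i ∈ T, ∀ j ∈ T, Compat (p i) (p j)

/-- `P` has stationary precaliber `ω₁`. -/
def StationaryPrecaliber (P : Type*) [PartialOrder P] : Prop :=
  ∀ S : Set Ordinal, IsStationaryOmega1 S → ∀ p : Ordinal → P,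
    ∃ T ⊆ S, IsStationaryOmega1 T ∧ Centered (p '' T)

/-- `P` is Knaster: every family of ℵ₁-many conditions has an uncountable
linked subfamily. -/
def Knaster (P : Type*) [PartialOrder P] : Prop :=
  ∀ p : Ordinal → P, ∃ X ⊆ Set.Iio omega1, ¬ X.Countable ∧
    ∀ i ∈ X, ∀ j ∈ X, Compat (p i) (p j)

/-- The principle ◊*. -/
def DiamondStar : Prop :=
  ∃ 𝒮 : Ordinal → Set (Set Ordinal),
    (∀ α < omega1, (𝒮 α).Countable ∧ ∀ s ∈ 𝒮 α, s ⊆ Set.Iio α) ∧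
    ∀ X : Set Ordinal, X ⊆ Set.Iio omega1 →
      ∃ D, IsClubOmega1 D ∧ ∀ α ∈ D, X ∩ Set.Iio α ∈ 𝒮 α

theorem omega1_eq : omega1 = Ordinal.omega 1 := Cardinal.ord_aleph 1

theorem zero_lt_omega1 : 0 < omega1 := by
  rw [omega1_eq]
  exact Ordinal.omega_pos 1

theorem succ_lt_omega1 {α : Ordinal} (hα : α < omega1) : Order.succ α < omega1 := by
  rw [omega1_eq] at *
  exact (Cardinal.isSuccLimit_omega 1).succ_lt hα

theorem countable_Iio_of_lt_omega1 {α : Ordinal.{0}} (hα : α < omega1) : (Iio α).Countable := by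
  rw [← Cardinal.le_aleph0_iff_set_countable, Cardinal.mk_Iio_ordinal,
    Cardinal.lift_le_aleph0, ← Cardinal.lt_aleph_one_iff]
  exact Cardinal.lt_ord.1 hα

theorem exists_lt_omega1_of_countable {A : Set Ordinal.{0}} (hA : A.Countable)
    (h : ∀ a ∈ A, a < omega1) : ∃ γ < omega1, ∀ a ∈ A, a < γ := by
  have := hA.to_subtype
  refine ⟨Order.succ (⨆ a : A, a.1), succ_lt_omega1 ?_, fun a ha ↦
    Order.lt_succ_iff.2 (Ordinal.le_iSup (fun a : A ↦ a.1) ⟨a, ha⟩)⟩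
  rw [omega1_eq] at *
  exact Ordinal.iSup_lt_omega_one fun a ↦ h a a.2

/-- `j` is a nonzero closure point of `f`. -/
def ClosurePoint (f : Ordinal.{0} → Ordinal.{0}) (j : Ordinal.{0}) : Prop :=
  j ≠ 0 ∧ ∀ β < j, f β < j

theorem exists_closurePoint {f : Ordinal.{0} → Ordinal.{0}} (hf : ∀ β < omega1, f β < omega1)
    {α : Ordinal.{0}} (hα : α < omega1) : ∃ j < omega1, α < j ∧ ClosurePoint f j := by
  have key : ∀ β : Iio omega1, ∃ γ : Iio omega1, β < γ ∧ ∀ b ≤ β.1, f b < γ := by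
    rintro ⟨β, hβ⟩
    obtain ⟨γ, hγ, h⟩ := exists_lt_omega1_of_countable
      (A := insert β (f '' Iio (Order.succ β)))
      (((countable_Iio_of_lt_omega1 (succ_lt_omega1 hβ)).image f).insert β) (by
        rintro a (rfl | ⟨b, hb, rfl⟩)
        · exact hβ
        · exact hf b ((Order.lt_succ_iff.1 hb).trans_lt hβ))
    exact ⟨⟨γ, hγ⟩, h β (Or.inl rfl),
      fun b hb ↦ h _ (Or.inr ⟨b, Order.lt_succ_iff.2 hb, rfl⟩)⟩
  choose g hg hgf using key
  let a : ℕ → Iio omega1 := fun n ↦ g^[n] ⟨α, hα⟩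
  have ha : ∀ n, a (n + 1) = g (a n) := fun n ↦ Function.iterate_succ_apply' g n _
  let j : Ordinal.{0} := ⨆ n, (a n).1
  have hj : j < omega1 := by
    rw [omega1_eq]
    exact Ordinal.iSup_lt_omega_one fun n ↦ by rw [← omega1_eq]; exact (a n).2
  have hlt : ∀ n, (a n).1 < j := fun n ↦
    (show (a n).1 < (a (n + 1)).1 by rw [ha]; exact hg _).trans_le
      (Ordinal.le_iSup (fun n ↦ (a n).1) (n + 1))
  refine ⟨j, hj, hlt 0, (bot_le.trans_lt (hlt 0)).ne', fun β hβ ↦ ?_⟩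
  obtain ⟨n, hn⟩ := Ordinal.lt_iSup_iff.1 hβ
  refine lt_trans ?_ (hlt (n + 1))
  rw [ha]
  exact hgf _ _ hn.le

theorem isClubOmega1_closurePoint {f : Ordinal.{0} → Ordinal.{0}}
    (hf : ∀ β < omega1, f β < omega1) : IsClubOmega1 {j | j < omega1 ∧ ClosurePoint f j} := by
  refine ⟨fun j hj ↦ hj.1, fun α hα ↦ ?_, fun α hα h0 h ↦ ⟨hα, h0, fun β hβ ↦ ?_⟩⟩
  · obtain ⟨j, h1, h2, h3⟩ := exists_closurePoint hf hα
    exact ⟨j, ⟨h1, h3⟩, h2⟩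
  · obtain ⟨γ, hγ, h1, h2⟩ := h β hβ
    exact (hγ.2.2 β h1).trans h2

/-- Every club contains all closure points of some function on `ω₁`. -/
theorem IsClubOmega1.exists_closurePoint_mem {C : Set Ordinal.{0}} (hC : IsClubOmega1 C) :
    ∃ f : Ordinal.{0} → Ordinal.{0}, (∀ β < omega1, f β < omega1) ∧
      ∀ j < omega1, ClosurePoint f j → j ∈ C := by
  have : ∀ β, ∃ γ, β < omega1 → γ ∈ C ∧ β < γ := fun β ↦ by
    by_cases hβ : β < omega1
    · obtain ⟨γ, h⟩ := hC.2.1 β hβ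
      exact ⟨γ, fun _ ↦ h⟩
    · exact ⟨0, fun h ↦ absurd h hβ⟩
  choose f hf using this
  exact ⟨f, fun β hβ ↦ hC.1 (hf β hβ).1, fun j hj hfj ↦ hC.2.2 j hj hfj.1 fun β hβ ↦
    ⟨f β, (hf β (hβ.trans hj)).1, (hf β (hβ.trans hj)).2, hfj.2 β hβ⟩⟩

theorem isStationaryOmega1_iff {S : Set Ordinal.{0}} :
    IsStationaryOmega1 S ↔ S ⊆ Iio omega1 ∧ ∀ f : Ordinal.{0} → Ordinal.{0},
      (∀ β < omega1, f β < omega1) → ∃ j ∈ S, ClosurePoint f j := by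
  refine and_congr_right fun hS ↦ ⟨fun h f hf ↦ ?_, fun h C hC ↦ ?_⟩
  · obtain ⟨j, hj, hj'⟩ := h _ (isClubOmega1_closurePoint hf)
    exact ⟨j, hj, hj'.2⟩
  · obtain ⟨f, hf, h'⟩ := hC.exists_closurePoint_mem
    obtain ⟨j, hj, hfj⟩ := h f hf
    exact ⟨j, hj, h' j (hS hj) hfj⟩

theorem ClosurePoint.of_max_left {f g : Ordinal.{0} → Ordinal.{0}} {j : Ordinal.{0}}
    (h : ClosurePoint (fun β ↦ max (f β) (g β)) j) : ClosurePoint f j :=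
  ⟨h.1, fun β hβ ↦ (le_max_left _ _).trans_lt (h.2 β hβ)⟩

theorem ClosurePoint.of_max_right {f g : Ordinal.{0} → Ordinal.{0}} {j : Ordinal.{0}}
    (h : ClosurePoint (fun β ↦ max (f β) (g β)) j) : ClosurePoint g j :=
  ⟨h.1, fun β hβ ↦ (le_max_right _ _).trans_lt (h.2 β hβ)⟩

theorem IsStationaryOmega1.inter_closurePoint {S : Set Ordinal.{0}} (hS : IsStationaryOmega1 S)
    {f : Ordinal.{0} → Ordinal.{0}} (hf : ∀ β < omega1, f β < omega1) :
    IsStationaryOmega1 {j ∈ S | ClosurePoint f j} := by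
  refine isStationaryOmega1_iff.2 ⟨fun j hj ↦ hS.1 hj.1, fun g hg ↦ ?_⟩
  obtain ⟨j, hj, h⟩ := (isStationaryOmega1_iff.1 hS).2 (fun β ↦ max (f β) (g β))
    fun β hβ ↦ max_lt (hf β hβ) (hg β hβ)
  exact ⟨j, ⟨hj, h.of_max_left⟩, h.of_max_right⟩

theorem IsStationaryOmega1.mono {S T : Set Ordinal.{0}} (hS : IsStationaryOmega1 S) (h : S ⊆ T)
    (hT : T ⊆ Iio omega1) : IsStationaryOmega1 T :=
  ⟨hT, fun C hC ↦ (hS.2 C hC).mono (inter_subset_inter_left _ h)⟩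

theorem isStationaryOmega1_Iio : IsStationaryOmega1 (Iio omega1) := by
  refine isStationaryOmega1_iff.2 ⟨subset_rfl, fun f hf ↦ ?_⟩
  obtain ⟨j, h1, -, h2⟩ := exists_closurePoint hf zero_lt_omega1
  exact ⟨j, h1, h2⟩

theorem IsStationaryOmega1.exists_gt {S : Set Ordinal.{0}} (hS : IsStationaryOmega1 S)
    {α : Ordinal.{0}} (hα : α < omega1) : ∃ j ∈ S, α < j := by
  obtain ⟨j, hj, h⟩ := (isStationaryOmega1_iff.1 hS).2 (fun _ ↦ α) fun _ _ ↦ hα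
  exact ⟨j, hj, h.2 0 (pos_of_ne_zero h.1)⟩

theorem IsStationaryOmega1.not_countable {S : Set Ordinal.{0}} (hS : IsStationaryOmega1 S) :
    ¬ S.Countable := fun h ↦ by
  obtain ⟨γ, hγ, h'⟩ := exists_lt_omega1_of_countable h fun a ha ↦ hS.1 ha
  obtain ⟨j, hj, hlt⟩ := hS.exists_gt hγ
  exact (hlt.trans (h' j hj)).false

/-- Fodor's pressing down lemma. -/
theorem IsStationaryOmega1.exists_fiber {S : Set Ordinal.{0}} (hS : IsStationaryOmega1 S)
    {f : Ordinal.{0} → Ordinal.{0}} (hf : ∀ j ∈ S, f j < j) :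
    ∃ d, IsStationaryOmega1 {j ∈ S | f j = d} := by
  by_contra! hcon
  have : ∀ d, ∃ g : Ordinal.{0} → Ordinal.{0}, (∀ β < omega1, g β < omega1) ∧
      ∀ j ∈ S, f j = d → ¬ ClosurePoint g j := fun d ↦ by
    have := hcon d
    rw [isStationaryOmega1_iff] at this
    push Not at this
    obtain ⟨g, hg, h⟩ := this fun j hj ↦ hS.1 hj.1
    exact ⟨g, hg, fun j hj hd ↦ h j ⟨hj, hd⟩⟩
  choose g hg hcl using this
  have : ∀ β, ∃ γ, β < omega1 → γ < omega1 ∧ ∀ d ≤ β, ∀ b ≤ β, g d b < γ := fun β ↦ by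
    by_cases hβ : β < omega1
    · have hc := countable_Iio_of_lt_omega1 (succ_lt_omega1 hβ)
      obtain ⟨γ, hγ, h⟩ := exists_lt_omega1_of_countable (hc.image2 hc g) (by
        rintro _ ⟨d, hd, b, hb, rfl⟩
        exact hg d b ((Order.lt_succ_iff.1 hb).trans_lt hβ))
      exact ⟨γ, fun _ ↦ ⟨hγ, fun d hd b hb ↦
        h _ ⟨d, Order.lt_succ_iff.2 hd, b, Order.lt_succ_iff.2 hb, rfl⟩⟩⟩
    · exact ⟨0, fun h ↦ absurd h hβ⟩
  choose F hF using this
  obtain ⟨j, hj, h0, hFj⟩ := (isStationaryOmega1_iff.1 hS).2 F fun β hβ ↦ (hF β hβ).1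
  refine hcl (f j) j hj rfl ⟨h0, fun β hβ ↦ ?_⟩
  have hm : max (f j) β < j := max_lt (hf j hj) hβ
  exact ((hF _ (hm.trans (hS.1 hj))).2 _ (le_max_left _ _) _ (le_max_right _ _)).trans (hFj _ hm)

/-- The nonstationary ideal is countably complete. -/
theorem IsStationaryOmega1.exists_fiber_countable {S : Set Ordinal.{0}}
    (hS : IsStationaryOmega1 S) {β : Type*} {B : Set β} (hB : B.Countable) {f : Ordinal.{0} → β}
    (hf : ∀ j ∈ S, f j ∈ B) : ∃ b, IsStationaryOmega1 {j ∈ S | f j = b} := by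
  obtain ⟨j₀, hj₀, -⟩ := hS.exists_gt zero_lt_omega1
  obtain ⟨e, he⟩ := countable_iff_exists_injOn.1 hB
  have hω : Ordinal.omega0 < omega1 := by
    rw [omega1_eq]; exact Ordinal.omega0_lt_omega_one
  have hS' := hS.inter_closurePoint (f := fun _ ↦ Ordinal.omega0) fun _ _ ↦ hω
  obtain ⟨d, hd⟩ := hS'.exists_fiber (f := fun j ↦ (e (f j) : Ordinal)) fun j hj ↦
    (Ordinal.natCast_lt_omega0 _).trans (hj.2.2 0 (pos_of_ne_zero hj.2.1))
  obtain ⟨i, hi, -⟩ := hd.exists_gt zero_lt_omega1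
  refine ⟨f i, hd.mono (fun j hj ↦ ⟨hj.1.1, he (hf j hj.1.1) (hf i hi.1.1) ?_⟩)
    fun j hj ↦ hS.1 hj.1⟩
  exact_mod_cast hj.2.trans hi.2.symm

/-- `s` is unbounded in `α`. -/
def UnboundedIn (s : Set Ordinal.{0}) (α : Ordinal.{0}) : Prop :=
  ∀ β < α, ∃ γ ∈ s, β < γ ∧ γ < α

theorem UnboundedIn.exists_gt_finset {s : Set Ordinal.{0}} {α : Ordinal.{0}} (hs : UnboundedIn s α)
    (h0 : α ≠ 0) (F : Finset Ordinal.{0}) (hF : ∀ β ∈ F, β < α) :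
    ∃ γ ∈ s, γ < α ∧ ∀ β ∈ F, β < γ := by
  obtain ⟨γ, h1, h2, h3⟩ := hs (F.sup id) ((Finset.sup_lt_iff (bot_lt_iff_ne_bot.2 h0)).2 hF)
  exact ⟨γ, h1, h3, fun β hβ ↦ (Finset.le_sup (f := id) hβ).trans_lt h2⟩

/-- Given countably many unbounded subsets of a countable ordinal `α`, there is a set of pairs,
only finitely many of which start below any `β < α`, such that each of the given sets contains some
pair and separates all but finitely many pairs. -/
theorem exists_ladder_pairs {α : Ordinal.{0}} (hα : α < omega1) (h0 : α ≠ 0)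
    {U : Set (Set Ordinal.{0})} (hU : U.Countable) (hsub : ∀ s ∈ U, UnboundedIn s α) :
    ∃ E : Set (Ordinal.{0} × Ordinal.{0}),
      (∀ e ∈ E, e.1 < e.2 ∧ e.2 < α) ∧
      (∀ β < α, {e ∈ E | e.1 ≤ β}.Finite) ∧
      (∀ s ∈ U, {e ∈ E | ∀ c ∈ s, e.1 < c → e.2 < c}.Finite) ∧
      ∀ s ∈ U, ∃ e ∈ E, e.1 ∈ s ∧ e.2 ∈ s := by
  rcases U.eq_empty_or_nonempty with rfl | hne
  · exact ⟨∅, by simp⟩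
  obtain ⟨u, rfl⟩ := hU.exists_eq_range hne
  obtain ⟨b, hb⟩ := (countable_Iio_of_lt_omega1 hα).exists_eq_range ⟨0, pos_of_ne_zero h0⟩
  have hbα : ∀ n, b n < α := fun n ↦ (hb.symm ▸ mem_range_self n : b n ∈ Iio α)
  have hx : ∀ n, ∃ x ∈ u n, x < α ∧ ∀ k ≤ n, b k < x := fun n ↦ by
    obtain ⟨x, h1, h2, h3⟩ := (hsub _ (mem_range_self n)).exists_gt_finset h0
      ((Finset.range (n + 1)).image b) (by simpa using fun k _ ↦ hbα k)
    exact ⟨x, h1, h2, fun k hk ↦ h3 _ (Finset.mem_image_of_mem _ (by simpa [Nat.lt_succ_iff]))⟩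
  choose x hxu hxα hxb using hx
  have hc : ∀ n m, ∃ c ∈ u m, x n < c ∧ c < α := fun n m ↦
    hsub _ (mem_range_self m) _ (hxα n)
  choose c hcu hxc hcα using hc
  have hy : ∀ n, ∃ y ∈ u n, y < α ∧ ∀ m ≤ n, c n m < y := fun n ↦ by
    obtain ⟨y, h1, h2, h3⟩ := (hsub _ (mem_range_self n)).exists_gt_finset h0
      ((Finset.range (n + 1)).image (c n)) (by simpa using fun k _ ↦ hcα n k)
    exact ⟨y, h1, h2, fun k hk ↦ h3 _ (Finset.mem_image_of_mem _ (by simpa [Nat.lt_succ_iff]))⟩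
  choose y hyu hyα hcy using hy
  have hfin : ∀ k, ((fun n ↦ (x n, y n)) '' Iio k).Finite := fun k ↦ (finite_Iio k).image _
  refine ⟨range fun n ↦ (x n, y n), ?_, fun β hβ ↦ ?_, ?_, ?_⟩
  · rintro _ ⟨n, rfl⟩
    exact ⟨(hxc n n).trans (hcy n n le_rfl), hyα n⟩
  · obtain ⟨k, rfl⟩ : β ∈ range b := hb ▸ hβ
    refine (hfin k).subset ?_
    rintro _ ⟨⟨n, rfl⟩, hn⟩
    exact ⟨n, not_le.1 fun hk ↦ (hxb n k hk).not_ge hn, rfl⟩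
  · rintro _ ⟨m, rfl⟩
    refine (hfin m).subset ?_
    rintro _ ⟨⟨n, rfl⟩, hn⟩
    exact ⟨n, not_le.1 fun hm ↦ ((hcy n m hm).trans (hn _ (hcu n m) (hxc n m))).false, rfl⟩
  · rintro _ ⟨n, rfl⟩
    exact ⟨_, ⟨n, rfl⟩, hxu n, hyu n⟩

theorem DiamondStar.exists_ladder_system (h : DiamondStar) :
    ∃ E : Ordinal.{0} → Set (Ordinal.{0} × Ordinal.{0}),
      (∀ α, ∀ e ∈ E α, e.1 < e.2 ∧ e.2 < α) ∧
      (∀ α, ∀ β < α, {e ∈ E α | e.1 ≤ β}.Finite) ∧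
      ∀ X ⊆ Iio omega1, (∀ β < omega1, ∃ γ ∈ X, β < γ) →
        ∃ f : Ordinal.{0} → Ordinal.{0}, (∀ β < omega1, f β < omega1) ∧
          ∀ j < omega1, ClosurePoint f j →
            {e ∈ E j | ∀ c ∈ X, e.1 < c → e.2 < c}.Finite ∧ ∃ e ∈ E j, e.1 ∈ X ∧ e.2 ∈ X := by
  obtain ⟨𝒮, h𝒮, hguess⟩ := h
  have key : ∀ α, ∃ E : Set (Ordinal.{0} × Ordinal.{0}),
      (∀ e ∈ E, e.1 < e.2 ∧ e.2 < α) ∧ (∀ β < α, {e ∈ E | e.1 ≤ β}.Finite) ∧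
      (α < omega1 → α ≠ 0 → ∀ s ∈ 𝒮 α, UnboundedIn s α →
        {e ∈ E | ∀ c ∈ s, e.1 < c → e.2 < c}.Finite ∧ ∃ e ∈ E, e.1 ∈ s ∧ e.2 ∈ s) := fun α ↦ by
    by_cases hα : α < omega1 ∧ α ≠ 0
    · obtain ⟨E, h1, h2, h3, h4⟩ := exists_ladder_pairs hα.1 hα.2
        (U := {s ∈ 𝒮 α | UnboundedIn s α}) ((h𝒮 α hα.1).1.mono fun s hs ↦ hs.1) fun s hs ↦ hs.2
      exact ⟨E, h1, h2, fun _ _ s hs hu ↦ ⟨h3 s ⟨hs, hu⟩, h4 s ⟨hs, hu⟩⟩⟩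
    · exact ⟨∅, by simp, by simp, fun h1 h2 ↦ absurd ⟨h1, h2⟩ hα⟩
  choose E hE1 hE2 hE3 using key
  refine ⟨E, hE1, hE2, fun X hX hunb ↦ ?_⟩
  obtain ⟨D, hD, hDX⟩ := hguess X hX
  obtain ⟨f, hf, hfD⟩ := hD.exists_closurePoint_mem
  choose! g hgX hg using hunb
  refine ⟨fun β ↦ max (f β) (g β), fun β hβ ↦ max_lt (hf β hβ) (hX (hgX β hβ)),
    fun j hj hcl ↦ ?_⟩
  obtain ⟨hfin, e, he, he1, he2⟩ := hE3 j hj hcl.1 _ (hDX j (hfD j hj hcl.of_max_left))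
    fun β hβ ↦ ⟨g β, ⟨hgX β (hβ.trans hj), hcl.of_max_right.2 β hβ⟩, hg β (hβ.trans hj),
      hcl.of_max_right.2 β hβ⟩
  exact ⟨hfin.subset fun e he ↦ ⟨he.1, fun c hc ↦ he.2 c hc.1⟩, e, he, he1.1, he2.1⟩

theorem IsStationaryOmega1.exists_thinning {S : Set Ordinal.{0}} (hS : IsStationaryOmega1 S)
    {p : Ordinal.{0} → Finset Ordinal.{0}} (hp : ∀ i, ∀ β ∈ p i, β < omega1)
    {g : Ordinal.{0} → Ordinal.{0}} (hg : ∀ i ∈ S, g i < i) :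
    ∃ T ⊆ S, IsStationaryOmega1 T ∧
      (∀ i ∈ T, ∀ j ∈ T, ∀ β ∈ p i, β < i → β ∈ p j ∧ β < j) ∧
      (∀ i ∈ T, ∀ j ∈ T, g j < i) ∧ ∀ i ∈ T, ∀ j ∈ T, i < j → ∀ β ∈ p i, β < j := by
  have hr : ∀ j ∈ S, max (g j) (((p j).filter (· < j)).sup id) < j := fun j hj ↦
    max_lt (hg j hj) ((Finset.sup_lt_iff (bot_le.trans_lt (hg j hj))).2 (by simp))
  obtain ⟨d, hd⟩ := hS.exists_fiber hr
  obtain ⟨i₀, hi₀, -⟩ := hd.exists_gt zero_lt_omega1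
  have hd₁ : d < omega1 := by
    rw [← hi₀.2]; exact (hr i₀ hi₀.1).trans (hS.1 hi₀.1)
  have hB : {F : Finset Ordinal.{0} | (F : Set Ordinal.{0}) ⊆ Iio (Order.succ d)}.Countable :=
    (((countable_ofPred_finite_subset (countable_Iio_of_lt_omega1
      (succ_lt_omega1 hd₁))).preimage (f := fun F : Finset Ordinal.{0} ↦ (F : Set Ordinal.{0}))
      Finset.coe_injective)).mono fun F hF ↦ show _ ∧ _ from ⟨F.finite_toSet, hF⟩
  obtain ⟨r, hr'⟩ := hd.exists_fiber_countable hB (f := fun j ↦ (p j).filter (· < j))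
    fun j hj β hβ ↦ Order.lt_succ_iff.2 <|
      (Finset.le_sup (f := id) hβ).trans ((le_max_right _ _).trans hj.2.le)
  have hT := hr'.inter_closurePoint (f := fun β ↦ (p β).sup id) fun β hβ ↦
    (Finset.sup_lt_iff zero_lt_omega1).2 (hp β)
  refine ⟨_, fun j hj ↦ hj.1.1.1, hT, ?_, ?_, ?_⟩
  · intro i hi j hj β hβ hlt
    have : (p i).filter (· < i) = (p j).filter (· < j) := hi.1.2.trans hj.1.2.symm
    simpa [hβ, hlt] using Finset.ext_iff.1 this β
  · intro i hi j hj
    calc g j ≤ d := (le_max_left _ _).trans hj.1.1.2.le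
      _ < i := hi.1.1.2 ▸ hr i hi.1.1.1
  · intro i hi j hj hij β hβ
    exact (Finset.le_sup (f := id) hβ).trans_lt (hj.2.2 i hij)

/-- `F` is a finite subset of `ω₁` containing no set `insert α e` with `e ∈ E α`. -/
def IsFree (E : Ordinal.{0} → Set (Finset Ordinal.{0})) (F : Finset Ordinal.{0}) : Prop :=
  (∀ α ∈ F, α < omega1) ∧ ∀ α ∈ F, ∀ e ∈ E α, ¬ e ⊆ F

/-- The free finite sets, ordered by reverse inclusion. -/
abbrev FreePoset (E : Ordinal.{0} → Set (Finset Ordinal.{0})) : Type 1 :=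
  {F : Finset Ordinal.{0} // IsFree E F}ᵒᵈ

section FreePoset

variable {E : Ordinal.{0} → Set (Finset Ordinal.{0})}

theorem isFree_empty : IsFree E ∅ := by simp [IsFree]

theorem isFree_singleton (hE : ∀ α, ∀ e ∈ E α, e.Nonempty ∧ ∀ x ∈ e, x < α) {α : Ordinal.{0}}
    (hα : α < omega1) : IsFree E {α} := by
  refine ⟨by simpa, fun β hβ e he hsub ↦ ?_⟩
  obtain rfl := Finset.mem_singleton.1 hβ
  obtain ⟨⟨x, hx⟩, hlt⟩ := hE β e he
  exact (hlt x hx).ne (Finset.mem_singleton.1 (hsub hx))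

open Classical in
theorem compat_of_isFree_union {p q : FreePoset E}
    (h : IsFree E ((OrderDual.ofDual p).1 ∪ (OrderDual.ofDual q).1)) : Compat p q :=
  ⟨OrderDual.toDual ⟨_, h⟩, Finset.subset_union_left, Finset.subset_union_right⟩

theorem Compat.symm {P : Type*} [PartialOrder P] {p q : P} (h : Compat p q) : Compat q p :=
  let ⟨r, h1, h2⟩ := h
  ⟨r, h2, h1⟩

open Classical in
theorem IsFree.union {p q : Finset Ordinal.{0}} (hE : ∀ α, ∀ e ∈ E α, ∀ x ∈ e, x < α)
    (hp : IsFree E p) (hq : IsFree E q) {i j : Ordinal.{0}}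
    (hpj : ∀ β ∈ p, β < j) (hqp : ∀ β ∈ q, β < j → β ∈ p) (hpq : ∀ β ∈ p, β < i → β ∈ q)
    (habove : ∀ α ∈ q, j < α → ∀ e ∈ E α, ∀ x ∈ e, x < j → x < i)
    (hj : j ∈ q → ∀ e ∈ E j, e ⊆ p → ∀ x ∈ e, x < i) : IsFree E (p ∪ q) := by
  refine ⟨fun α hα ↦ (Finset.mem_union.1 hα).elim (hp.1 α) (hq.1 α), fun α hα e he hsub ↦ ?_⟩
  have low : α ≤ j → e ⊆ p := fun hle x hx ↦
    (Finset.mem_union.1 (hsub hx)).elim id fun h ↦ hqp x h ((hE α e he x hx).trans_le hle)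
  by_cases hαp : α ∈ p
  · exact hp.2 α hαp e he (low (hpj α hαp).le)
  have hαq : α ∈ q := (Finset.mem_union.1 hα).resolve_left hαp
  rcases lt_trichotomy α j with hlt | rfl | hlt
  · exact hαp (hqp α hαq hlt)
  · have hep := low le_rfl
    exact hq.2 α hαq e he fun x hx ↦ hpq x (hep hx) (hj hαq e he hep x hx)
  · refine hq.2 α hαq e he fun x hx ↦ (Finset.mem_union.1 (hsub hx)).elim (fun h ↦ ?_) id
    exact hpq x h (habove α hαq hlt e he x hx (hpj x h))

theorem finite_below (hfin : ∀ α, ∀ β < α, {e ∈ E α | ∃ x ∈ e, x ≤ β}.Finite)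
    (q : Finset Ordinal.{0}) (j : Ordinal.{0}) :
    {x | x < j ∧ ∃ α ∈ q, j < α ∧ ∃ e ∈ E α, x ∈ e}.Finite := by
  have : (⋃ α ∈ {α : Ordinal.{0} | α ∈ q ∧ j < α},
      ⋃ e ∈ {e ∈ E α | ∃ x ∈ e, x ≤ j}, (e : Set Ordinal.{0})).Finite :=
    Finite.biUnion ((q.finite_toSet).subset fun α hα ↦ hα.1) fun α hα ↦
      (hfin α j hα.2).biUnion fun e _ ↦ e.finite_toSet
  refine this.subset fun x hx ↦ ?_
  obtain ⟨hxj, α, hα, hjα, e, he, hxe⟩ := hx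
  exact mem_biUnion (show α ∈ {α | α ∈ q ∧ j < α} from ⟨hα, hjα⟩)
    (mem_biUnion (show e ∈ {e ∈ E α | ∃ x ∈ e, x ≤ j} from ⟨he, x, hxe, hxj.le⟩) hxe)

end FreePoset

theorem Set.Finite.exists_lt_bound {A : Set Ordinal.{0}} (hA : A.Finite) {j : Ordinal.{0}}
    (h0 : j ≠ 0) (h : ∀ x ∈ A, x < j) : ∃ d < j, ∀ x ∈ A, x ≤ d :=
  ⟨hA.toFinset.sup id, (Finset.sup_lt_iff (bot_lt_iff_ne_bot.2 h0)).2 (by simpa using h),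
    fun _ hx ↦ Finset.le_sup (f := id) (hA.mem_toFinset.2 hx)⟩

section FreePoset

variable {E : Ordinal.{0} → Set (Finset Ordinal.{0})}

open Classical in
/-- The condition `{i}` for `i < ω₁`, and the trivial condition otherwise. -/
def singletonCondition (hE : ∀ α, ∀ e ∈ E α, e.Nonempty ∧ ∀ x ∈ e, x < α) (i : Ordinal.{0}) :
    FreePoset E :=
  OrderDual.toDual <| if h : i < omega1 then ⟨{i}, isFree_singleton hE h⟩ else ⟨∅, isFree_empty⟩

theorem mem_of_le_singletonCondition {hE : ∀ α, ∀ e ∈ E α, e.Nonempty ∧ ∀ x ∈ e, x < α}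
    {i : Ordinal.{0}} (hi : i < omega1) {r : FreePoset E} (hr : r ≤ singletonCondition hE i) :
    i ∈ (OrderDual.ofDual r).1 := by
  rw [singletonCondition, dif_pos hi] at hr
  exact hr (Finset.mem_singleton_self i)

theorem knaster_freePoset (hE : ∀ α, ∀ e ∈ E α, ∀ x ∈ e, x < α)
    (hfin : ∀ α, ∀ β < α, {e ∈ E α | ∃ x ∈ e, x ≤ β}.Finite) : Knaster (FreePoset E) := by
  intro p
  let a : Ordinal.{0} → Finset Ordinal.{0} := fun i ↦ (OrderDual.ofDual (p i)).1
  have ha : ∀ i, IsFree E (a i) := fun i ↦ (OrderDual.ofDual (p i)).2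
  obtain ⟨T, -, hT, hroot, -, -⟩ := (isStationaryOmega1_Iio.inter_closurePoint
    (f := fun _ ↦ 0) fun _ _ ↦ zero_lt_omega1).exists_thinning (fun i ↦ (ha i).1)
    (g := fun _ ↦ 0) fun i hi ↦ pos_of_ne_zero hi.2.1
  have hnext : ∀ i < omega1, ∃ k ∈ T, i < k := fun i hi ↦ hT.exists_gt hi
  choose! k hkT hk using hnext
  have hT' := hT.inter_closurePoint (f := k) fun β hβ ↦ hT.1 (hkT β hβ)
  have hg : ∀ j ∈ {j ∈ T | ClosurePoint k j}, ∃ d < j,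
      ∀ x ∈ {x | x < j ∧ ∃ α ∈ a (k j), j < α ∧ ∃ e ∈ E α, x ∈ e}, x ≤ d := fun j hj ↦
    (finite_below hfin (a (k j)) j).exists_lt_bound hj.2.1 fun x hx ↦ hx.1
  choose! g hgj hg using hg
  obtain ⟨T', hT'sub, hT', -, hgT', hlt⟩ := hT'.exists_thinning
    (p := fun i ↦ a (k i)) (fun i ↦ (ha _).1) hgj
  have hω : ∀ i ∈ T', i < omega1 := fun i hi ↦ hT'.1 hi
  have hkk : ∀ i ∈ T', ∀ j ∈ T', i < j → k i < j := fun i hi j hj hij ↦ (hT'sub hj).2.2 i hij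
  have hcompat : ∀ i ∈ T', ∀ j ∈ T', i < j → Compat (p (k i)) (p (k j)) := by
    intro i hi j hj hij
    have hki := hkT i (hω i hi)
    have hkj := hkT j (hω j hj)
    refine compat_of_isFree_union (IsFree.union hE (ha (k i)) (ha (k j)) (i := i) (j := j)
      (hlt i hi j hj hij) ?_ ?_ ?_ ?_)
    · exact fun β hβ hβj ↦ (hroot _ hkj _ hki β hβ (hβj.trans (hk j (hω j hj)))).1
    · exact fun β hβ hβi ↦ (hroot _ hki _ hkj β hβ (hβi.trans (hk i (hω i hi)))).1
    · exact fun α hα hjα e he x hx hxj ↦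
        (hg j (hT'sub hj) x ⟨hxj, α, hα, hjα, e, he, hx⟩).trans_lt (hgT' i hi j hj)
    · intro hja
      have := (hroot _ hkj _ hki j hja (hk j (hω j hj))).2
      exact absurd (hkk i hi j hj hij) this.not_gt
  have hmono : ∀ i ∈ T', ∀ j ∈ T', i < j → k i < k j := fun i hi j hj hij ↦
    (hkk i hi j hj hij).trans (hk j (hω j hj))
  refine ⟨k '' T', ?_, fun hc ↦ hT'.not_countable ?_, ?_⟩
  · rintro _ ⟨i, hi, rfl⟩
    exact hT.1 (hkT i (hω i hi))
  · refine countable_of_injective_of_countable_image (fun i hi j hj hij ↦ ?_) hc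
    by_contra hne
    rcases lt_or_gt_of_ne hne with h | h
    · exact (hmono i hi j hj h).ne hij
    · exact (hmono j hj i hi h).ne' hij
  · rintro _ ⟨i, hi, rfl⟩ _ ⟨j, hj, rfl⟩
    rcases lt_trichotomy i j with h | rfl | h
    · exact hcompat i hi j hj h
    · exact ⟨_, le_rfl, le_rfl⟩
    · exact (hcompat j hj i hi h).symm

end FreePoset

section Ladders

variable {L : Ordinal.{0} → Set (Ordinal.{0} × Ordinal.{0})}

open Classical in
theorem stationarilyKnaster_freePoset (hlt : ∀ α, ∀ e ∈ L α, e.1 < e.2 ∧ e.2 < α)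
    (hfin : ∀ α, ∀ β < α, {e ∈ L α | e.1 ≤ β}.Finite)
    (hsep : ∀ X ⊆ Iio omega1, (∀ β < omega1, ∃ γ ∈ X, β < γ) →
        ∃ f : Ordinal.{0} → Ordinal.{0}, (∀ β < omega1, f β < omega1) ∧
          ∀ j < omega1, ClosurePoint f j → {e ∈ L j | ∀ c ∈ X, e.1 < c → e.2 < c}.Finite) :
    StationarilyKnaster (FreePoset fun α ↦ (fun e ↦ {e.1, e.2}) '' L α) := by
  set E : Ordinal.{0} → Set (Finset Ordinal.{0}) := fun α ↦ (fun e ↦ {e.1, e.2}) '' L α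
  intro S hS p
  have hE : ∀ α, ∀ e ∈ E α, ∀ x ∈ e, x < α := by
    rintro α _ ⟨e, he, rfl⟩ x hx
    obtain ⟨h1, h2⟩ := hlt α e he
    rcases Finset.mem_insert.1 hx with rfl | hx
    · exact h1.trans h2
    · rwa [Finset.mem_singleton.1 hx]
  have hfinE : ∀ α, ∀ β < α, {e ∈ E α | ∃ x ∈ e, x ≤ β}.Finite := fun α β hβ ↦ by
    refine ((hfin α β hβ).image fun e ↦ ({e.1, e.2} : Finset Ordinal.{0})).subset ?_
    rintro _ ⟨⟨e, he, rfl⟩, x, hx, hxβ⟩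
    refine ⟨e, ⟨he, ?_⟩, rfl⟩
    rcases Finset.mem_insert.1 hx with rfl | hx
    · exact hxβ
    · exact (hlt α e he).1.le.trans (Finset.mem_singleton.1 hx ▸ hxβ)
  let a : Ordinal.{0} → Finset Ordinal.{0} := fun i ↦ (OrderDual.ofDual (p i)).1
  have ha : ∀ i, IsFree E (a i) := fun i ↦ (OrderDual.ofDual (p i)).2
  let b : Ordinal.{0} → Ordinal.{0} := fun i ↦ (a i).sup Order.succ
  have hab : ∀ i, ∀ β ∈ a i, β < b i := fun i β hβ ↦
    Order.succ_le_iff.1 (Finset.le_sup (f := Order.succ) hβ)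
  have hb : ∀ i < omega1, b i < omega1 := fun i _ ↦
    (Finset.sup_lt_iff zero_lt_omega1).2 fun β hβ ↦ succ_lt_omega1 ((ha i).1 β hβ)
  have hC := isClubOmega1_closurePoint hb
  obtain ⟨f, hf, hfC⟩ := hsep _ hC.1 hC.2.1
  have hS' := hS.inter_closurePoint hf
  have hg : ∀ j ∈ {j ∈ S | ClosurePoint f j}, ∃ d < j,
      ∀ x, ((x < j ∧ ∃ α ∈ a j, j < α ∧ ∃ e ∈ E α, x ∈ e) ∨
        ∃ e ∈ L j, (e.1 ∈ a j ∨ ∀ c ∈ {i | i < omega1 ∧ ClosurePoint b i}, e.1 < c → e.2 < c) ∧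
          x ≤ e.2) → x ≤ d := by
    intro j hj
    have h1 : {e ∈ L j | e.1 ∈ a j}.Finite := by
      have : (⋃ x ∈ {x | x ∈ a j ∧ x < j}, {e ∈ L j | e.1 ≤ x}).Finite :=
        Finite.biUnion ((a j).finite_toSet.subset fun x hx ↦ hx.1) fun x hx ↦ hfin j x hx.2
      refine this.subset fun e he ↦ mem_biUnion (x := e.1) ?_ ?_
      · exact ⟨he.2, (hlt j e he.1).1.trans (hlt j e he.1).2⟩
      · exact ⟨he.1, le_rfl⟩
    have h2 := (h1.union (hfC j (hS.1 hj.1) hj.2)).image Prod.snd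
    obtain ⟨d, hdj, hd⟩ := ((finite_below hfinE (a j) j).union h2).exists_lt_bound hj.2.1 (by
      rintro x (hx | ⟨e, he | he, rfl⟩)
      · exact hx.1
      · exact (hlt j e he.1).2
      · exact (hlt j e he.1).2)
    refine ⟨d, hdj, ?_⟩
    rintro x (hx | ⟨e, he, he' | he', hx⟩)
    · exact hd x (Or.inl hx)
    · exact hx.trans (hd _ (Or.inr ⟨e, Or.inl ⟨he, he'⟩, rfl⟩))
    · exact hx.trans (hd _ (Or.inr ⟨e, Or.inr ⟨he, he'⟩, rfl⟩))
  choose! g hgj hg using hg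
  obtain ⟨T, hTS, hT, hroot, hgT, hTlt⟩ := hS'.exists_thinning (fun i ↦ (ha i).1) hgj
  have hcompat : ∀ i ∈ T, ∀ j ∈ T, i < j → Compat (p i) (p j) := by
    intro i hi j hj hij
    refine compat_of_isFree_union (IsFree.union hE (ha i) (ha j) (i := i) (j := j)
      (hTlt i hi j hj hij) (fun β hβ hβj ↦ (hroot j hj i hi β hβ hβj).1)
      (fun β hβ hβi ↦ (hroot i hi j hj β hβ hβi).1) ?_ ?_)
    · exact fun α hα hjα e he x hx hxj ↦
        (hg j (hTS hj) x (Or.inl ⟨hxj, α, hα, hjα, e, he, hx⟩)).trans_lt (hgT i hi j hj)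
    · rintro - _ ⟨e, he, rfl⟩ hsub x hx
      have he1 : e.1 ∈ a i := hsub (by simp)
      have he2 : e.2 ∈ a i := hsub (by simp)
      have hx2 : x ≤ e.2 := by
        rcases Finset.mem_insert.1 hx with rfl | hx
        · exact (hlt j e he).1.le
        · exact (Finset.mem_singleton.1 hx).le
      refine (hg j (hTS hj) x (Or.inr ⟨e, he, ?_, hx2⟩)).trans_lt (hgT i hi j hj)
      rcases lt_or_ge e.1 i with h | h
      · exact Or.inl (hroot i hi j hj _ he1 h).1
      · exact Or.inr fun c hc hec ↦ (hab i _ he2).trans (hc.2.2 i (h.trans_lt hec))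
  refine ⟨T, fun j hj ↦ (hTS hj).1, hT, fun i hi j hj ↦ ?_⟩
  rcases lt_trichotomy i j with h | rfl | h
  · exact hcompat i hi j hj h
  · exact ⟨_, le_rfl, le_rfl⟩
  · exact (hcompat j hj i hi h).symm

theorem IsStationaryOmega1.exists_ladder_subset (hmem : ∀ X ⊆ Iio omega1,
      (∀ β < omega1, ∃ γ ∈ X, β < γ) → ∃ f : Ordinal.{0} → Ordinal.{0},
        (∀ β < omega1, f β < omega1) ∧
          ∀ j < omega1, ClosurePoint f j → ∃ e ∈ L j, e.1 ∈ X ∧ e.2 ∈ X)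
    {T : Set Ordinal.{0}} (hT : IsStationaryOmega1 T) :
    ∃ j ∈ T, ∃ e ∈ L j, e.1 ∈ T ∧ e.2 ∈ T := by
  obtain ⟨f, hf, hfT⟩ := hmem T hT.1 fun β hβ ↦ hT.exists_gt hβ
  obtain ⟨j, hj, hcl⟩ := (isStationaryOmega1_iff.1 hT).2 f hf
  exact ⟨j, hj, hfT j (hT.1 hj) hcl⟩

theorem not_stationarilyKnaster_freePoset (hlt : ∀ α, ∀ e ∈ L α, e.1 < e.2 ∧ e.2 < α)
    (hmem : ∀ T, IsStationaryOmega1 T → ∃ j ∈ T, ∃ e ∈ L j, e.1 ∈ T ∧ e.2 ∈ T) :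
    ¬ StationarilyKnaster (FreePoset fun α ↦ (fun e ↦ {e.1}) '' L α) := by
  intro h
  obtain ⟨T, -, hT, hcompat⟩ := h _ isStationaryOmega1_Iio <| singletonCondition <| by
    rintro α _ ⟨e, he, rfl⟩
    simpa using (hlt α e he).1.trans (hlt α e he).2
  obtain ⟨j, hj, e, he, he1, -⟩ := hmem T hT
  obtain ⟨r, hr1, hr2⟩ := hcompat _ he1 _ hj
  exact (OrderDual.ofDual r).2.2 j (mem_of_le_singletonCondition (hT.1 hj) hr2) _ ⟨e, he, rfl⟩
    (Finset.singleton_subset_iff.2 (mem_of_le_singletonCondition (hT.1 he1) hr1))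

open Classical in
theorem not_stationaryPrecaliber_freePoset (hlt : ∀ α, ∀ e ∈ L α, e.1 < e.2 ∧ e.2 < α)
    (hmem : ∀ T, IsStationaryOmega1 T → ∃ j ∈ T, ∃ e ∈ L j, e.1 ∈ T ∧ e.2 ∈ T) :
    ¬ StationaryPrecaliber (FreePoset fun α ↦ (fun e ↦ {e.1, e.2}) '' L α) := by
  intro h
  have hE : ∀ α, ∀ e ∈ (fun e ↦ ({e.1, e.2} : Finset Ordinal.{0})) '' L α,
      e.Nonempty ∧ ∀ x ∈ e, x < α := by
    rintro α _ ⟨e, he, rfl⟩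
    simpa using ⟨(hlt α e he).1.trans (hlt α e he).2, (hlt α e he).2⟩
  obtain ⟨T, -, hT, hcentered⟩ := h _ isStationaryOmega1_Iio (singletonCondition hE)
  obtain ⟨j, hj, e, he, he1, he2⟩ := hmem T hT
  obtain ⟨r, hr⟩ := hcentered (({e.1, e.2, j} : Finset Ordinal.{0}).image (singletonCondition hE))
    (by
      rw [Finset.coe_image]
      refine image_mono fun x hx ↦ ?_
      rcases (by simpa using hx : x = e.1 ∨ x = e.2 ∨ x = j) with rfl | rfl | rfl <;> assumption)
  have hmem : ∀ x ∈ ({e.1, e.2, j} : Finset Ordinal.{0}), x ∈ T → x ∈ (OrderDual.ofDual r).1 :=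
    fun x hx hxT ↦ mem_of_le_singletonCondition (hT.1 hxT) (hr _ (Finset.mem_image_of_mem _ hx))
  refine (OrderDual.ofDual r).2.2 j (hmem j (by simp) hj) _ ⟨e, he, rfl⟩ ?_
  rw [Finset.insert_subset_iff, Finset.singleton_subset_iff]
  exact ⟨hmem _ (by simp) he1, hmem _ (by simp) he2⟩

end Ladders

/-- ◊* implies: (1) there is a Knaster partial order which is not stationarily
Knaster, and (2) there is a stationarily Knaster partial order which does not
have stationary precaliber ω₁. -/
theorem diamondStar_Knaster_separations (h : DiamondStar) :
    (∃ (P : Type 1) (inst : PartialOrder P),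
      @Knaster P inst ∧ ¬ @StationarilyKnaster P inst) ∧
    (∃ (P : Type 1) (inst : PartialOrder P),
      @StationarilyKnaster P inst ∧ ¬ @StationaryPrecaliber P inst) := by
  obtain ⟨L, hlt, hfin, hguess⟩ := h.exists_ladder_system
  have hmem : ∀ T, IsStationaryOmega1 T → ∃ j ∈ T, ∃ e ∈ L j, e.1 ∈ T ∧ e.2 ∈ T := fun T hT ↦
    hT.exists_ladder_subset fun X hX hunb ↦
      (hguess X hX hunb).imp fun f hf ↦ ⟨hf.1, fun j hj hcl ↦ (hf.2 j hj hcl).2⟩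
  refine ⟨⟨_, _, knaster_freePoset ?_ ?_, not_stationarilyKnaster_freePoset hlt hmem⟩,
    _, _, stationarilyKnaster_freePoset hlt hfin fun X hX hunb ↦
      (hguess X hX hunb).imp fun f hf ↦ ⟨hf.1, fun j hj hcl ↦ (hf.2 j hj hcl).1⟩,
    not_stationaryPrecaliber_freePoset hlt hmem⟩
  · rintro α _ ⟨e, he, rfl⟩
    simpa using (hlt α e he).1.trans (hlt α e he).2
  · refine fun α β hβ ↦ ((hfin α β hβ).image fun e ↦ ({e.1} : Finset Ordinal.{0})).subset ?_
    rintro _ ⟨⟨e, he, rfl⟩, x, hx, hxβ⟩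
    exact ⟨e, ⟨he, Finset.mem_singleton.1 hx ▸ hxβ⟩, rfl⟩
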